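/- Fix real parameters ε, a, γ and consider on ℝ⁴ with coordinates (x₁,x₂,x₃,x₄) the vector field X = x₃·∂_{x₂} − x₂·∂_{x₃}. Then the Lie derivative of the exponential-coordinate metric with equal parameters a₁ = a₂ = a satisfies L_X G_{ε,a,a,γ} = 0 at every point of ℝ⁴; that is, X is a Killing field of G_{ε,a,a,γ}. -/

import Mathlib

open Real Matrix

noncomputable section

/-- Points of `ℝ⁴`, with coordinates `(x₁,x₂,x₃,x₄)` indexed by `Fin 4`. -/
abbrev V4 := Fin 4 → ℝ

/-- Partial derivative `∂_i f` of a scalar function on `ℝ⁴`. -/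
noncomputable def pd (i : Fin 4) (f : V4 → ℝ) (x : V4) : ℝ :=
  fderiv ℝ f x (Pi.single i 1)

/-- The exponential-coordinate metric `G_{ε,a₁,a₂,γ}` on `ℝ⁴`. -/
noncomputable def Gexp (ε a₁ a₂ γ : ℝ) (x : V4) : Matrix (Fin 4) (Fin 4) ℝ :=
  !![(γ ^ 2 + a₁) * (x 1) ^ 2 + (γ ^ 2 + a₂) * (x 2) ^ 2 - 2 * ε * x 3, -γ * x 2, γ * x 1, 1;
     -γ * x 2, 1, 0, 0;
     γ * x 1, 0, 1, 0;
     1, 0, 0, 0]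

/-- The Lie derivative of a metric `g` along a vector field `X`:
`(L_X g)_{ab} = X^c ∂_c g_{ab} + (∂_a X^c) g_{cb} + (∂_b X^c) g_{ac}`. -/
noncomputable def lieDeriv (X : V4 → V4) (g : V4 → Matrix (Fin 4) (Fin 4) ℝ) (x : V4) :
    Matrix (Fin 4) (Fin 4) ℝ :=
  Matrix.of fun a b =>
    (∑ c, X x c * pd c (fun y => g y a b) x)
      + (∑ c, pd a (fun y => X y c) x * g x c b)
      + (∑ c, pd b (fun y => X y c) x * g x a c)

end

theorem pd_const (i : Fin 4) (r : ℝ) (x : V4) : pd i (fun _ => r) x = 0 := by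
  simp [pd]

theorem pd_of_hasFDerivAt {i : Fin 4} {f : V4 → ℝ} {f' : V4 →L[ℝ] ℝ} {x : V4}
    (h : HasFDerivAt f f' x) : pd i f x = f' (Pi.single i 1) := by
  rw [pd, h.fderiv]

theorem pd_coord (i j : Fin 4) (x : V4) :
    pd i (fun y => y j) x = (Pi.single i 1 : V4) j :=
  pd_of_hasFDerivAt (hasFDerivAt_apply j x)

theorem pd_neg (i : Fin 4) (f : V4 → ℝ) (x : V4) :
    pd i (fun y => -f y) x = -pd i f x := by
  simp [pd]

theorem pd_const_mul (i : Fin 4) (r : ℝ) {f : V4 → ℝ} {x : V4} (hf : DifferentiableAt ℝ f x) :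
    pd i (fun y => r * f y) x = r * pd i f x := by
  simp [pd, fderiv_const_mul hf]

theorem pd_const_mul_coord (i j : Fin 4) (r : ℝ) (x : V4) :
    pd i (fun y => r * y j) x = r * (Pi.single i 1 : V4) j := by
  rw [pd_const_mul i r (by fun_prop), pd_coord]

/-- Partial derivatives of the only non-affine component `G₁₁` of the metric. -/
theorem pd_Gexp_zero_zero (i : Fin 4) (p q r : ℝ) (x : V4) :
    pd i (fun y => p * y 1 ^ 2 + q * y 2 ^ 2 - r * y 3) x =
      2 * p * x 1 * (Pi.single i 1 : V4) 1 + 2 * q * x 2 * (Pi.single i 1 : V4) 2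
        - r * (Pi.single i 1 : V4) 3 := by
  have h (j : Fin 4) : HasFDerivAt (fun y : V4 => y j)
      (ContinuousLinearMap.proj (R := ℝ) (φ := fun _ : Fin 4 => ℝ) j) x :=
    hasFDerivAt_apply j x
  refine (pd_of_hasFDerivAt (((((h 1).pow 2).const_mul p).add
    (((h 2).pow 2).const_mul q)).sub ((h 3).const_mul r))).trans ?_
  simp
  ring

/-- when `a₁ = a₂ = a`, the rotation field
`X = x₃∂_{x₂} − x₂∂_{x₃}` is a Killing field of `G_{ε,a,a,γ}`: `L_X G = 0`. -/
theorem killing_field_Gexp (ε a γ : ℝ) (x : V4) :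
    lieDeriv (fun y => ![0, y 2, -y 1, 0]) (Gexp ε a a γ) x = 0 := by
  ext a b
  fin_cases a <;> fin_cases b <;>
    simp [lieDeriv, Gexp, Fin.sum_univ_four, pd_const, pd_coord, pd_neg, pd_const_mul_coord,
      pd_Gexp_zero_zero]
  all_goals ring
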